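/- Let X be a finite nonempty type of feature vectors, let the data universe be 𝒳 = X × {0,1} × {0,1}, and let datasets be probability distributions (PMFs) on 𝒳, with two datasets adjacent when their total variation distance is at most ζ, for a fixed ζ > 0 (so any two datasets are connected by a finite chain of adjacent datasets). Let H be the finite type of classifiers h : X × {0,1} → {0,1} and M : PMF(𝒳) → PMF(H) a randomized learning algorithm. If M satisfies ε-differential privacy for some finite ε ≥ 0, and for every dataset D every classifier h in the support of M(D) satisfies equal opportunity with respect to D, then every classifier in the support of M(D), for every dataset D, is trivial (constant). -/

import Mathlib

open scoped ENNReal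

/-- Probability of an event under a PMF, as a real number. -/
noncomputable def prP {α : Type*} (D : PMF α) (s : Set α) : ℝ :=
  (D.toOuterMeasure s).toReal

/-- Conditional probability `P_D(s | t)` under a PMF, as a real number. -/
noncomputable def cprP {α : Type*} (D : PMF α) (s t : Set α) : ℝ :=
  prP D (s ∩ t) / prP D t

/-- Equal opportunity of a classifier `h : X × {0,1} → {0,1}` with respect to a
distribution `D` on the data universe `X × {0,1} × {0,1}` (elements `z = (x, a, y)`). -/
def EqOppP {X : Type*} (D : PMF (X × Bool × Bool)) (h : X × Bool → Bool) : Prop :=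
  0 < prP D {z | z.2.2 = true ∧ z.2.1 = false} →
  0 < prP D {z | z.2.2 = true ∧ z.2.1 = true} →
    cprP D {z | h (z.1, z.2.1) = true} {z | z.2.2 = true ∧ z.2.1 = false} =
      cprP D {z | h (z.1, z.2.1) = true} {z | z.2.2 = true ∧ z.2.1 = true}

/-- The probabilities of a PMF on a finite type, as reals, sum to one. -/
lemma PMF.sum_toReal_eq_one {α : Type*} [Fintype α] (D : PMF α) :
    ∑ z, (D z).toReal = 1 := by
  rw [← ENNReal.toReal_sum fun z _ => D.apply_ne_top z,
    ← tsum_fintype (L := .unconditional α), D.tsum_coe, ENNReal.toReal_one]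

lemma PMF.convexCombination_nonneg {α : Type*} (D D' : PMF α) {t : ℝ}
    (ht : t ∈ Set.Icc (0 : ℝ) 1) (z : α) :
    0 ≤ (1 - t) * (D z).toReal + t * (D' z).toReal :=
  add_nonneg (mul_nonneg (sub_nonneg.2 ht.2) ENNReal.toReal_nonneg)
    (mul_nonneg ht.1 ENNReal.toReal_nonneg)

/-- The mixture `(1 - t) D + t D'` of two PMFs on a finite type. -/
noncomputable def PMF.mix {α : Type*} [Fintype α] (D D' : PMF α) (t : ℝ)
    (ht : t ∈ Set.Icc (0 : ℝ) 1) : PMF α :=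
  PMF.ofFintype (fun z => ENNReal.ofReal ((1 - t) * (D z).toReal + t * (D' z).toReal)) (by
    rw [← ENNReal.ofReal_sum_of_nonneg fun z _ => PMF.convexCombination_nonneg D D' ht z,
      Finset.sum_add_distrib, ← Finset.mul_sum, ← Finset.mul_sum,
      PMF.sum_toReal_eq_one, PMF.sum_toReal_eq_one]
    simp)

lemma PMF.mix_toReal {α : Type*} [Fintype α] (D D' : PMF α) (t : ℝ)
    (ht : t ∈ Set.Icc (0 : ℝ) 1) (z : α) :
    (D.mix D' t ht z).toReal = (1 - t) * (D z).toReal + t * (D' z).toReal := by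
  rw [PMF.mix, PMF.ofFintype_apply,
    ENNReal.toReal_ofReal (PMF.convexCombination_nonneg D D' ht z)]

lemma PMF.mix_zero {α : Type*} [Fintype α] (D D' : PMF α) :
    D.mix D' 0 (by simp) = D := by
  ext z
  rw [← ENNReal.toReal_eq_toReal_iff' (PMF.apply_ne_top _ z) (D.apply_ne_top z), PMF.mix_toReal]
  ring

lemma PMF.mix_one {α : Type*} [Fintype α] (D D' : PMF α) :
    D.mix D' 1 (by simp) = D' := by
  ext z
  rw [← ENNReal.toReal_eq_toReal_iff' (PMF.apply_ne_top _ z) (D'.apply_ne_top z), PMF.mix_toReal]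
  ring

lemma PMF.sum_abs_mix_sub_mix {α : Type*} [Fintype α] (D D' : PMF α) (s t : ℝ)
    (hs : s ∈ Set.Icc (0 : ℝ) 1) (ht : t ∈ Set.Icc (0 : ℝ) 1) :
    ∑ z, |(D.mix D' s hs z).toReal - (D.mix D' t ht z).toReal| =
      |t - s| * ∑ z, |(D z).toReal - (D' z).toReal| := by
  rw [Finset.mul_sum]
  refine Finset.sum_congr rfl fun z _ => ?_
  rw [PMF.mix_toReal, PMF.mix_toReal, ← abs_mul]
  congr 1
  ring

/-- A property of datasets preserved between `ζ`-close datasets is preserved between any two. -/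
lemma PMF.transfer_of_adjacent {α : Type*} [Fintype α] {ζ : ℝ} (hζ : 0 < ζ) {P : PMF α → Prop}
    (hP : ∀ D D' : PMF α, (1 / 2 : ℝ) * ∑ z, |(D z).toReal - (D' z).toReal| ≤ ζ → P D → P D')
    (D D' : PMF α) (hD : P D) : P D' := by
  set C : ℝ := ∑ z, |(D z).toReal - (D' z).toReal| with hC
  have hC0 : 0 ≤ C := Finset.sum_nonneg fun z _ => abs_nonneg _
  obtain ⟨n, hn⟩ := exists_nat_gt (1 / 2 * C / ζ)
  have hn0 : (0 : ℝ) < n := lt_of_le_of_lt (by positivity) hn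
  have hmem : ∀ k : ℕ, k ≤ n → (k / n : ℝ) ∈ Set.Icc (0 : ℝ) 1 := fun k hk =>
    ⟨by positivity, (div_le_one hn0).2 (by exact_mod_cast hk)⟩
  have key : ∀ (k : ℕ) (hk : k ≤ n), P (D.mix D' (k / n) (hmem k hk)) := by
    intro k
    induction k with
    | zero =>
      intro hk
      simpa [PMF.mix_zero] using hD
    | succ k ih =>
      intro hk
      refine hP _ _ ?_ (ih (by omega))
      have hstep : (((k + 1 : ℕ) : ℝ) / n - k / n) = 1 / n := by
        push_cast
        ring
      rw [PMF.sum_abs_mix_sub_mix, hstep, abs_of_pos (by positivity), ← hC]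
      rw [div_lt_iff₀ hζ] at hn
      calc 1 / 2 * (1 / n * C) = 1 / 2 * C / n := by ring
        _ ≤ ζ := by rw [div_le_iff₀ hn0]; linarith
  simpa [div_self hn0.ne', PMF.mix_one] using key n le_rfl

/-- The uniform distribution on the two positively labelled points `(x₀, 0, 1)`, `(x₁, 1, 1)`. -/
noncomputable def twoPointDataset {X : Type*} (x₀ x₁ : X) : PMF (X × Bool × Bool) :=
  (PMF.uniformOfFintype Bool).map fun a => (if a then x₁ else x₀, a, true)

open scoped Classical in
lemma prP_twoPointDataset {X : Type*} (x₀ x₁ : X) (s : Set (X × Bool × Bool)) :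
    prP (twoPointDataset x₀ x₁) s =
      (if (x₁, true, true) ∈ s then 1 / 2 else 0) +
        (if (x₀, false, true) ∈ s then 1 / 2 else 0) := by
  rw [prP, twoPointDataset, PMF.toOuterMeasure_map_apply, PMF.toOuterMeasure_apply_fintype,
    Fintype.sum_bool]
  by_cases h₁ : (x₁, true, true) ∈ s <;> by_cases h₀ : (x₀, false, true) ∈ s <;>
    simp [Set.indicator, h₁, h₀, ENNReal.toReal_add]

/-- Equal opportunity on a two-point dataset forces equal predictions on both points. -/
lemma EqOppP.apply_eq_of_twoPointDataset {X : Type*} {x₀ x₁ : X} {h : X × Bool → Bool}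
    (H : EqOppP (twoPointDataset x₀ x₁) h) : h (x₀, false) = h (x₁, true) := by
  simp only [EqOppP, cprP, prP_twoPointDataset] at H
  cases h₀ : h (x₀, false) <;> cases h₁ : h (x₁, true) <;> simp [h₀, h₁] at H ⊢

/-- No differentially private learning algorithm can guarantee to output only
classifiers that are fair (equal opportunity) unless all the classifiers it
outputs are trivial (constant).  Datasets are distributions on the data universe,
and two datasets are adjacent when their total variation distance is at most `ζ`. -/
theorem dp_and_equal_opportunity_implies_trivial
    {X : Type*} [Fintype X] [Nonempty X]
    (ζ : ℝ) (hζ : 0 < ζ) (ε : ℝ) (hε : 0 ≤ ε)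
    (M : PMF (X × Bool × Bool) → PMF (X × Bool → Bool))
    (hdp : ∀ D D' : PMF (X × Bool × Bool),
      (1 / 2 : ℝ) * ∑ z : X × Bool × Bool, |(D z).toReal - (D' z).toReal| ≤ ζ →
      ∀ S : Set (X × Bool → Bool),
        (M D).toOuterMeasure S ≤ ENNReal.ofReal (Real.exp ε) * (M D').toOuterMeasure S)
    (hfair : ∀ D : PMF (X × Bool × Bool), ∀ h ∈ (M D).support, EqOppP D h) :
    ∀ D : PMF (X × Bool × Bool), ∀ h ∈ (M D).support,
      ∀ z z' : X × Bool, h z = h z' := by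
  intro D h hh
  have hall : ∀ D', h ∈ (M D').support := fun D' =>
    PMF.transfer_of_adjacent hζ (P := fun D => h ∈ (M D).support)
      (fun D₁ D₂ hadj h₁ h₂ => h₁ <| by
        have hle := hdp D₁ D₂ hadj {h}
        rw [PMF.toOuterMeasure_apply_singleton, PMF.toOuterMeasure_apply_singleton, h₂,
          mul_zero] at hle
        exact le_antisymm hle zero_le) D D' hh
  have hcross : ∀ x₀ x₁ : X, h (x₀, false) = h (x₁, true) := fun x₀ x₁ =>
    (hfair _ h (hall (twoPointDataset x₀ x₁))).apply_eq_of_twoPointDataset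
  rintro ⟨x, a⟩ ⟨x', a'⟩
  cases a <;> cases a'
  · exact (hcross x x).trans (hcross x' x).symm
  · exact hcross x x'
  · exact (hcross x' x).symm
  · exact (hcross x x).symm.trans (hcross x x')
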